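/- Let n ≥ 1 and let δ₁, δ₂ be nonzero vectors in ℝⁿ. Then arccos( cos‖δ₁‖ · cos‖δ₂‖ + (sin‖δ₁‖/‖δ₁‖) · (sin‖δ₂‖/‖δ₂‖) · ⟨δ₁, δ₂⟩ ) ≤ ‖δ₁ − δ₂‖. (This is the triangle axiom for the sphere Sⁿ: the spherical distance between exp δ₁ and exp δ₂ is at most ‖δ₁ − δ₂‖, where exp δ = (cos‖δ‖, (sin‖δ‖/‖δ‖)·δ) ∈ ℝ × ℝⁿ and the spherical distance between unit vectors u, v is arccos⟨u, v⟩.) -/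

import Mathlib

open scoped RealInnerProductSpace

/-- `s ↦ cos √s` is convex on `[0, π²]`, since `sin x / x` is antitone on `(0, π]`. -/
theorem convexOn_cos_sqrt :
    ConvexOn ℝ (Set.Icc 0 (Real.pi ^ 2)) (fun s => Real.cos √s) := by
  have hd : ∀ s ∈ Set.Ioo 0 (Real.pi ^ 2),
      HasDerivAt (fun s => Real.cos √s) (-Real.sin √s * (1 / (2 * √s))) s := fun s hs =>
    (Real.hasDerivAt_sqrt hs.1.ne').cos
  apply MonotoneOn.convexOn_of_deriv (convex_Icc _ _)
  · fun_prop
  · rw [interior_Icc]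
    exact fun s hs => (hd s hs).differentiableAt.differentiableWithinAt
  · rw [interior_Icc]
    intro s hs t ht hst
    rw [(hd s hs).deriv, (hd t ht).deriv]
    have hs0 : 0 < √s := Real.sqrt_pos.2 hs.1
    have ht0 : 0 < √t := Real.sqrt_pos.2 ht.1
    have hle : √s ≤ √t := Real.sqrt_le_sqrt hst
    have hpi : √t ≤ Real.pi := Real.sqrt_le_iff.2 ⟨Real.pi_pos.le, ht.2.le⟩
    have h := strictConcaveOn_sin_Icc.concaveOn.neg.secant_mono
      (a := 0) (x := √s) (y := √t) ⟨le_rfl, Real.pi_pos.le⟩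
      ⟨hs0.le, hle.trans hpi⟩ ⟨ht0.le, hpi⟩ hs0.ne' ht0.ne' hle
    simp only [Pi.neg_apply, Real.sin_zero, neg_zero, sub_zero] at h
    calc -Real.sin √s * (1 / (2 * √s)) = (-Real.sin √s / √s) / 2 := by field_simp
      _ ≤ (-Real.sin √t / √t) / 2 := by gcongr
      _ = -Real.sin √t * (1 / (2 * √t)) := by field_simp

theorem neg_one_le_cos_mul_cos_add (a b t : ℝ) (h₁ : -1 ≤ t) (h₂ : t ≤ 1) :
    -1 ≤ Real.cos a * Real.cos b + Real.sin a * Real.sin b * t := by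
  have hs := Real.neg_one_le_cos (a - b)
  have ha := Real.neg_one_le_cos (a + b)
  rw [Real.cos_sub] at hs
  rw [Real.cos_add] at ha
  nlinarith

/-- Comparison of the planar and the spherical law of cosines, with `s` the square of the side
opposite to the angle in the planar triangle. -/
theorem cos_sqrt_le_cos_mul_cos_add {a b s : ℝ} (ha : 0 < a) (hb : 0 < b)
    (hs₁ : (a - b) ^ 2 ≤ s) (hs₂ : s ≤ (a + b) ^ 2) (hs : s ≤ Real.pi ^ 2) :
    Real.cos √s ≤
      Real.cos a * Real.cos b + Real.sin a * Real.sin b * ((a ^ 2 + b ^ 2 - s) / (2 * a * b)) := by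
  have key : ∀ r, s ≤ r → r ≤ Real.pi ^ 2 → Real.cos √r ≤
      Real.cos a * Real.cos b + Real.sin a * Real.sin b * ((a ^ 2 + b ^ 2 - r) / (2 * a * b)) →
      Real.cos √s ≤ Real.cos a * Real.cos b +
        Real.sin a * Real.sin b * ((a ^ 2 + b ^ 2 - s) / (2 * a * b)) := by
    intro r hsr hr h
    have hmem : s ∈ segment ℝ ((a - b) ^ 2) r := by
      rw [segment_eq_Icc (hs₁.trans hsr)]
      exact ⟨hs₁, hsr⟩
    obtain ⟨p, q, hp, hq, hpq, rfl⟩ := hmem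
    have hconv := convexOn_cos_sqrt.2 (x := (a - b) ^ 2) (y := r)
      ⟨sq_nonneg _, (hs₁.trans hsr).trans hr⟩
      ⟨(sq_nonneg _).trans (hs₁.trans hsr), hr⟩ hp hq hpq
    have h₀ : Real.cos √((a - b) ^ 2) = Real.cos a * Real.cos b + Real.sin a * Real.sin b *
        ((a ^ 2 + b ^ 2 - (a - b) ^ 2) / (2 * a * b)) := by
      rw [Real.sqrt_sq_eq_abs, Real.cos_abs, Real.cos_sub]
      field_simp
      ring
    simp only [smul_eq_mul] at hconv ⊢
    refine hconv.trans ?_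
    rw [h₀]
    refine (add_le_add_right (mul_le_mul_of_nonneg_left h hq) _).trans_eq ?_
    obtain rfl : p = 1 - q := by linarith
    ring
  rcases le_total ((a + b) ^ 2) (Real.pi ^ 2) with h | h
  · refine key _ hs₂ h (le_of_eq ?_)
    rw [Real.sqrt_sq (by positivity), Real.cos_add]
    field_simp
    ring
  · refine key _ hs le_rfl ?_
    rw [Real.sqrt_sq Real.pi_pos.le, Real.cos_pi]
    apply neg_one_le_cos_mul_cos_add
    · rw [le_div_iff₀ (by positivity)]
      linarith
    · rw [div_le_one (by positivity)]
      linarith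

/-- Triangle axiom for the sphere `Sⁿ`. For nonzero `δ₁, δ₂ ∈ ℝⁿ`,
the spherical distance between `exp δ₁` and `exp δ₂` is at most `‖δ₁ − δ₂‖`. -/
theorem sphere_triangle_axiom
    {n : ℕ} (hn : 1 ≤ n)
    (δ₁ δ₂ : EuclideanSpace ℝ (Fin n)) (h₁ : δ₁ ≠ 0) (h₂ : δ₂ ≠ 0) :
    Real.arccos (Real.cos ‖δ₁‖ * Real.cos ‖δ₂‖ +
        (Real.sin ‖δ₁‖ / ‖δ₁‖) * (Real.sin ‖δ₂‖ / ‖δ₂‖) * ⟪δ₁, δ₂⟫) ≤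
      ‖δ₁ - δ₂‖ := by
  rcases le_total Real.pi ‖δ₁ - δ₂‖ with h | h
  · exact (Real.arccos_le_pi _).trans h
  have ha : 0 < ‖δ₁‖ := norm_pos_iff.2 h₁
  have hb : 0 < ‖δ₂‖ := norm_pos_iff.2 h₂
  have hcos := cos_sqrt_le_cos_mul_cos_add (s := ‖δ₁ - δ₂‖ ^ 2) ha hb
    (sq_le_sq.2 (by rw [abs_norm]; exact abs_norm_sub_norm_le δ₁ δ₂))
    (by gcongr; exact norm_sub_le δ₁ δ₂) (by gcongr)
  rw [Real.sqrt_sq (norm_nonneg _)] at hcos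
  have harg : Real.cos ‖δ₁‖ * Real.cos ‖δ₂‖ +
        (Real.sin ‖δ₁‖ / ‖δ₁‖) * (Real.sin ‖δ₂‖ / ‖δ₂‖) * ⟪δ₁, δ₂⟫ =
      Real.cos ‖δ₁‖ * Real.cos ‖δ₂‖ + Real.sin ‖δ₁‖ * Real.sin ‖δ₂‖ *
        ((‖δ₁‖ ^ 2 + ‖δ₂‖ ^ 2 - ‖δ₁ - δ₂‖ ^ 2) / (2 * ‖δ₁‖ * ‖δ₂‖)) := by
    rw [norm_sub_sq_real]
    field_simp
    ring
  rw [harg]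
  exact (Real.arccos_le_arccos hcos).trans_eq (Real.arccos_cos (norm_nonneg _) h)
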